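/- Let ω be a weight on ℝ₊ with ω ∈ B_p(∞) and 1 < p < ∞. Then every u ∈ D^{1,p}(ℝ₊,ω) has a finite limit at infinity, Tr^∞(u) := lim_{t→∞} u(t) ∈ ℝ; moreover u(t) = Tr^∞(u) − ∫_t^∞ u'(τ) dτ for every t > 0, and for every t > 0 one has |u(t) − Tr^∞(u)| ≤ (∫_t^∞ |u'(τ)|^p ω(τ) dτ)^{1/p} · Ω^∞_ω(t). In addition, ‖u‖^{(∞)} := |Tr^∞(u)| + ‖u'‖_{L^p(ℝ₊,ω)} is a norm on D^{1,p}(ℝ₊,ω) equivalent to ‖·‖^{(a)} for every a ∈ ℝ₊. -/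

import Mathlib

open MeasureTheory Set Filter Topology
open scoped NNReal ENNReal

noncomputable section

/-- A weight on `ℝ₊ = (0,∞)`: continuous and positive there. -/
def IsWeight (ω : ℝ → ℝ) : Prop :=
  ContinuousOn ω (Set.Ioi 0) ∧ ∀ t : ℝ, 0 < t → 0 < ω t

/-- Membership of the pair `(u, u')` in the weighted Dirichlet space
`D^{1,p}(ℝ₊, ω)`: `u'` is locally integrable on `(0,∞)`, `u` is locally
absolutely continuous with derivative `u'`, and `∫_0^∞ |u'|^p ω < ∞`. -/
def MemD (p : ℝ) (ω u u' : ℝ → ℝ) : Prop :=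
  (∀ a b : ℝ, 0 < a → a < b → IntegrableOn u' (Set.Ioc a b)) ∧
  (∀ a b : ℝ, 0 < a → a < b → u b - u a = ∫ τ in a..b, u' τ) ∧
  IntegrableOn (fun t => |u' t| ^ p * ω t) (Set.Ioi 0)

/-- `‖u'‖_{L^p(ℝ₊, ω)} = (∫_0^∞ |u'(t)|^p ω(t) dt)^{1/p}`. -/
def dNorm (p : ℝ) (ω u' : ℝ → ℝ) : ℝ :=
  (∫ t in Set.Ioi (0:ℝ), |u' t| ^ p * ω t) ^ (1 / p)

/-- The norm `‖u‖^{(a)} = |u(a)| + ‖u'‖_{L^p(ℝ₊, ω)}`. -/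
def aNorm (p : ℝ) (ω : ℝ → ℝ) (a : ℝ) (u u' : ℝ → ℝ) : ℝ :=
  |u a| + dNorm p ω u'

/-- `ω ∈ B_p(0)`: `∫_0^1 ω(t)^{-1/(p-1)} dt < ∞`. -/
def Bp0 (p : ℝ) (ω : ℝ → ℝ) : Prop :=
  IntegrableOn (fun t => ω t ^ (-1 / (p - 1))) (Set.Ioc (0:ℝ) 1)

/-- `ω ∈ B_p(∞)`: `∫_1^∞ ω(t)^{-1/(p-1)} dt < ∞`. -/
def BpInf (p : ℝ) (ω : ℝ → ℝ) : Prop :=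
  IntegrableOn (fun t => ω t ^ (-1 / (p - 1))) (Set.Ioi (1:ℝ))

/-- `Ω^0_ω(t) = (∫_0^t ω(τ)^{-1/(p-1)} dτ)^{1-1/p}`. -/
def Omega0 (p : ℝ) (ω : ℝ → ℝ) (t : ℝ) : ℝ :=
  (∫ τ in Set.Ioc (0:ℝ) t, ω τ ^ (-1 / (p - 1))) ^ (1 - 1 / p)

/-- `Ω^∞_ω(t) = (∫_t^∞ ω(τ)^{-1/(p-1)} dτ)^{1-1/p}`. -/
def OmegaInf (p : ℝ) (ω : ℝ → ℝ) (t : ℝ) : ℝ :=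
  (∫ τ in Set.Ioi t, ω τ ^ (-1 / (p - 1))) ^ (1 - 1 / p)

/-- `R^0_{p,ω}(c)`: elements of `D^{1,p}(ℝ₊,ω)` with
`u(t) = c + ∫_0^t u'(τ) dτ` for every `t > 0`. -/
def MemR0 (p : ℝ) (ω : ℝ → ℝ) (c : ℝ) (u u' : ℝ → ℝ) : Prop :=
  MemD p ω u u' ∧ ∀ t : ℝ, 0 < t →
    IntegrableOn u' (Set.Ioc 0 t) ∧ u t = c + ∫ τ in Set.Ioc (0:ℝ) t, u' τ

/-- `R^∞_{p,ω}(c)`: elements of `D^{1,p}(ℝ₊,ω)` with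
`u(t) = c - ∫_t^∞ u'(τ) dτ` for every `t > 0`. -/
def MemRInf (p : ℝ) (ω : ℝ → ℝ) (c : ℝ) (u u' : ℝ → ℝ) : Prop :=
  MemD p ω u u' ∧ ∀ t : ℝ, 0 < t →
    IntegrableOn u' (Set.Ioi t) ∧ u t = c - ∫ τ in Set.Ioi t, u' τ

/-- `D_0^{1,p}(ℝ₊,ω)`: elements of `D^{1,p}(ℝ₊,ω)` approximable by smooth
compactly supported functions on `(0,∞)`, with derivatives converging in
`L^p(ℝ₊,ω)` and locally uniform convergence on compact subsets of `(0,∞)`. -/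
def MemD0 (p : ℝ) (ω u u' : ℝ → ℝ) : Prop :=
  MemD p ω u u' ∧
  ∃ φ : ℕ → ℝ → ℝ,
    (∀ n, ContDiff ℝ (⊤ : ℕ∞) (φ n) ∧ HasCompactSupport (φ n) ∧ tsupport (φ n) ⊆ Set.Ioi 0) ∧
    Tendsto (fun n => ∫ t in Set.Ioi (0:ℝ), |deriv (φ n) t - u' t| ^ p * ω t)
      atTop (𝓝 0) ∧
    (∀ K : Set ℝ, K ⊆ Set.Ioi 0 → IsCompact K →
      TendstoUniformlyOn (fun n => φ n) u atTop K)

lemma integrableOn_rpow_Ioi_of_bpInf {p : ℝ} {ω : ℝ → ℝ} (hω : IsWeight ω) (hB : BpInf p ω)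
    {t : ℝ} (ht : 0 < t) : IntegrableOn (fun τ => ω τ ^ (-1 / (p - 1))) (Ioi t) := by
  have hcont : ContinuousOn (fun τ => ω τ ^ (-1 / (p - 1))) (Icc t 1) :=
    (hω.1.mono fun x hx => lt_of_lt_of_le ht hx.1).rpow_const
      fun x hx => Or.inl (hω.2 x (lt_of_lt_of_le ht hx.1)).ne'
  refine (hcont.integrableOn_Icc.union hB).mono_set fun x hx => ?_
  rcases le_or_gt x 1 with h | h
  · exact Or.inl ⟨le_of_lt hx, h⟩
  · exact Or.inr h

lemma MemD.aestronglyMeasurable {p : ℝ} {ω u u' : ℝ → ℝ} (hu : MemD p ω u u') {t : ℝ}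
    (ht : 0 < t) : AEStronglyMeasurable u' (volume.restrict (Ioi t)) := by
  have hU : Ioi t = ⋃ n : ℕ, Ioc t (t + (n + 1)) := by
    ext x
    simp only [mem_Ioi, mem_iUnion, mem_Ioc]
    refine ⟨fun hx => ?_, fun ⟨n, hn⟩ => hn.1⟩
    obtain ⟨n, hn⟩ := exists_nat_gt (x - t)
    exact ⟨n, hx, by linarith⟩
  rw [hU, aestronglyMeasurable_iUnion_iff]
  exact fun n => (hu.1 t _ ht (by linarith [n.cast_nonneg (α := ℝ)])).aestronglyMeasurable

/-- Hölder's inequality for `u' = (u' ω^{1/p}) ω^{-1/p}` on `(t,∞)`. -/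
lemma MemD.integrableOn_Ioi_and_integral_abs_le {p : ℝ} {ω u u' : ℝ → ℝ} (hp : 1 < p)
    (hω : IsWeight ω) (hB : BpInf p ω) (hu : MemD p ω u u') {t : ℝ} (ht : 0 < t) :
    IntegrableOn u' (Ioi t) ∧
      ∫ τ in Ioi t, |u' τ| ≤ (∫ τ in Ioi t, |u' τ| ^ p * ω τ) ^ (1 / p) * OmegaInf p ω t := by
  have hp0 : 0 < p := by linarith
  have hp1 : p - 1 ≠ 0 := by linarith
  have hpq : p.HolderConjugate (Real.conjExponent p) := Real.HolderConjugate.conjExponent hp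
  set q := Real.conjExponent p with hq
  have hsub : Ioi t ⊆ Ioi (0 : ℝ) := Ioi_subset_Ioi ht.le
  have hpos : ∀ x ∈ Ioi t, 0 < ω x := fun x hx => hω.2 x (hsub hx)
  have hcont (s : ℝ) : ContinuousOn (fun τ => ω τ ^ s) (Ioi t) :=
    (hω.1.mono hsub).rpow_const fun x hx => Or.inl (hpos x hx).ne'
  have hmeas (s : ℝ) : AEStronglyMeasurable (fun τ => ω τ ^ s) (volume.restrict (Ioi t)) :=
    (hcont s).aestronglyMeasurable measurableSet_Ioi
  have hu'm := hu.aestronglyMeasurable ht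
  have hfm : AEStronglyMeasurable (fun τ => |u' τ| * ω τ ^ (1 / p)) (volume.restrict (Ioi t)) :=
    hu'm.norm.mul (hmeas _)
  have hfp : ∀ x ∈ Ioi t, (|u' x| * ω x ^ (1 / p)) ^ p = |u' x| ^ p * ω x := fun x hx => by
    rw [Real.mul_rpow (abs_nonneg _) (Real.rpow_nonneg (hpos x hx).le _),
      ← Real.rpow_mul (hpos x hx).le, one_div_mul_cancel hp0.ne', Real.rpow_one]
  have hgq : ∀ x ∈ Ioi t, (ω x ^ (-1 / p)) ^ q = ω x ^ (-1 / (p - 1)) := fun x hx => by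
    rw [← Real.rpow_mul (hpos x hx).le, hq, Real.conjExponent]
    congr 1
    field_simp
  have hfg : ∀ x ∈ Ioi t, |u' x| * ω x ^ (1 / p) * ω x ^ (-1 / p) = |u' x| := fun x hx => by
    rw [mul_assoc, ← Real.rpow_add (hpos x hx), ← add_div, add_neg_cancel, zero_div,
      Real.rpow_zero, mul_one]
  have hf0 : ∀ x ∈ Ioi t, 0 ≤ |u' x| * ω x ^ (1 / p) := fun x hx =>
    mul_nonneg (abs_nonneg _) (Real.rpow_nonneg (hpos x hx).le _)
  have hg0 : ∀ x ∈ Ioi t, 0 ≤ ω x ^ (-1 / p) := fun x hx => Real.rpow_nonneg (hpos x hx).le _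
  have hfL : MemLp (fun τ => |u' τ| * ω τ ^ (1 / p)) (ENNReal.ofReal p)
      (volume.restrict (Ioi t)) := by
    rw [← integrable_norm_rpow_iff hfm (by simpa using hp0) ENNReal.ofReal_ne_top,
      ENNReal.toReal_ofReal hp0.le]
    refine (hu.2.2.mono_set hsub).congr_fun (fun x hx => ?_) measurableSet_Ioi
    simp only [Real.norm_of_nonneg (hf0 x hx), hfp x hx]
  have hgL : MemLp (fun τ => ω τ ^ (-1 / p)) (ENNReal.ofReal q) (volume.restrict (Ioi t)) := by
    rw [← integrable_norm_rpow_iff (hmeas _) (by simpa using hpq.symm.pos)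
      ENNReal.ofReal_ne_top, ENNReal.toReal_ofReal hpq.symm.nonneg]
    refine (integrableOn_rpow_Ioi_of_bpInf hω hB ht).congr_fun (fun x hx => ?_) measurableSet_Ioi
    simp only [Real.norm_of_nonneg (hg0 x hx), hgq x hx]
  have hae {P : ℝ → Prop} (h : ∀ x ∈ Ioi t, P x) : ∀ᵐ x ∂volume.restrict (Ioi t), P x :=
    ae_restrict_of_forall_mem measurableSet_Ioi h
  constructor
  · have : ENNReal.HolderConjugate (ENNReal.ofReal p) (ENNReal.ofReal q) := hpq.ennrealOfReal
    refine (integrable_norm_iff hu'm).1 ((hfL.integrable_mul hgL).congr (hae fun x hx => ?_))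
    exact hfg x hx
  · have := integral_mul_le_Lp_mul_Lq_of_nonneg hpq (hae hf0) (hae hg0) hfL hgL
    rwa [setIntegral_congr_fun measurableSet_Ioi hfg, setIntegral_congr_fun measurableSet_Ioi hfp,
      setIntegral_congr_fun measurableSet_Ioi hgq,
      show 1 / q = 1 - 1 / p by rw [one_div, one_div, hpq.one_sub_inv]] at this

lemma MemD.tendsto_atTop {p : ℝ} {ω u u' : ℝ → ℝ} (hu : MemD p ω u u') {t : ℝ} (ht : 0 < t)
    (hi : IntegrableOn u' (Ioi t)) : Tendsto u atTop (𝓝 (u t + ∫ τ in Ioi t, u' τ)) := by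
  refine ((intervalIntegral_tendsto_integral_Ioi t hi tendsto_id).const_add (u t)).congr' ?_
  filter_upwards [eventually_gt_atTop t] with b hb
  rw [id, ← hu.2.1 t b ht hb]
  ring

lemma MemD.eq_sub_integral_Ioi {p : ℝ} {ω u u' : ℝ → ℝ} {c : ℝ} (hu : MemD p ω u u')
    (hc : Tendsto u atTop (𝓝 c)) {t : ℝ} (ht : 0 < t) (hi : IntegrableOn u' (Ioi t)) :
    u t = c - ∫ τ in Ioi t, u' τ := by
  linarith [tendsto_nhds_unique hc (hu.tendsto_atTop ht hi)]

lemma MemD.abs_sub_le {p : ℝ} {ω u u' : ℝ → ℝ} {c : ℝ} (hp : 1 < p)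
    (hω : IsWeight ω) (hB : BpInf p ω) (hu : MemD p ω u u') (hc : Tendsto u atTop (𝓝 c))
    {t : ℝ} (ht : 0 < t) :
    |u t - c| ≤ (∫ τ in Ioi t, |u' τ| ^ p * ω τ) ^ (1 / p) * OmegaInf p ω t := by
  obtain ⟨hi, hle⟩ := hu.integrableOn_Ioi_and_integral_abs_le hp hω hB ht
  rw [hu.eq_sub_integral_Ioi hc ht hi, sub_sub_cancel_left, abs_neg]
  exact abs_integral_le_integral_abs.trans hle

lemma omegaInf_nonneg {p : ℝ} {ω : ℝ → ℝ} (hω : IsWeight ω) {t : ℝ} (ht : 0 < t) :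
    0 ≤ OmegaInf p ω t :=
  Real.rpow_nonneg (setIntegral_nonneg measurableSet_Ioi fun x hx =>
    Real.rpow_nonneg (hω.2 x (ht.trans hx)).le _) _

lemma dNorm_nonneg {p : ℝ} {ω : ℝ → ℝ} (hω : IsWeight ω) (u' : ℝ → ℝ) : 0 ≤ dNorm p ω u' :=
  Real.rpow_nonneg (setIntegral_nonneg measurableSet_Ioi fun x hx =>
    mul_nonneg (Real.rpow_nonneg (abs_nonneg _) _) (hω.2 x hx).le) _

lemma MemD.abs_sub_le_dNorm {p : ℝ} {ω u u' : ℝ → ℝ} {c : ℝ} (hp : 1 < p)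
    (hω : IsWeight ω) (hB : BpInf p ω) (hu : MemD p ω u u') (hc : Tendsto u atTop (𝓝 c))
    {t : ℝ} (ht : 0 < t) : |u t - c| ≤ dNorm p ω u' * OmegaInf p ω t := by
  have hnn : ∀ x ∈ Ioi (0 : ℝ), 0 ≤ |u' x| ^ p * ω x := fun x hx =>
    mul_nonneg (Real.rpow_nonneg (abs_nonneg _) _) (hω.2 x hx).le
  have hsub : Ioi t ⊆ Ioi (0 : ℝ) := Ioi_subset_Ioi ht.le
  refine (hu.abs_sub_le hp hω hB hc ht).trans
    (mul_le_mul_of_nonneg_right ?_ (omegaInf_nonneg hω ht))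
  refine Real.rpow_le_rpow (setIntegral_nonneg measurableSet_Ioi fun x hx => hnn x (hsub hx))
    (setIntegral_mono_set hu.2.2 (ae_restrict_of_forall_mem measurableSet_Ioi hnn)
      hsub.eventuallyLE) (by positivity)

/-- for `ω ∈ B_p(∞)`, every `u ∈ D^{1,p}(ℝ₊,ω)` has a finite
trace at infinity `Tr^∞(u) = lim_{t→∞} u(t)`, with the representation
`u(t) = Tr^∞(u) - ∫_t^∞ u'` and the estimate
`|u(t) - Tr^∞(u)| ≤ (∫_t^∞ |u'|^p ω)^{1/p} · Ω^∞_ω(t)`; moreover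
`‖u‖^{(∞)} = |Tr^∞(u)| + ‖u'‖_{L^p(ℝ₊,ω)}` is a norm on `D^{1,p}(ℝ₊,ω)`
equivalent to every `‖·‖^{(a)}`, `a ∈ ℝ₊`. -/
theorem stmt7 (p : ℝ) (ω : ℝ → ℝ) (hp : 1 < p) (hω : IsWeight ω)
    (hB : BpInf p ω) :
    (∀ u u' : ℝ → ℝ, MemD p ω u u' → ∃ c : ℝ, Tendsto u atTop (𝓝 c) ∧
      (∀ t : ℝ, 0 < t → IntegrableOn u' (Set.Ioi t) ∧
        u t = c - ∫ τ in Set.Ioi t, u' τ) ∧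
      (∀ t : ℝ, 0 < t →
        |u t - c| ≤ (∫ τ in Set.Ioi t, |u' τ| ^ p * ω τ) ^ (1 / p)
          * OmegaInf p ω t)) ∧
    (∀ (u u' : ℝ → ℝ) (c : ℝ), MemD p ω u u' → Tendsto u atTop (𝓝 c) →
      (0 ≤ |c| + dNorm p ω u') ∧
      (|c| + dNorm p ω u' = 0 → ∀ t : ℝ, 0 < t → u t = 0)) ∧
    (∀ a : ℝ, 0 < a → ∃ C : ℝ, 1 ≤ C ∧
      ∀ (u u' : ℝ → ℝ) (c : ℝ), MemD p ω u u' → Tendsto u atTop (𝓝 c) →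
        C⁻¹ * (|c| + dNorm p ω u') ≤ aNorm p ω a u u' ∧
        aNorm p ω a u u' ≤ C * (|c| + dNorm p ω u')) := by
  refine ⟨fun u u' hu => ?_, fun u u' c hu hc => ?_, fun a ha => ?_⟩
  · have hi {t : ℝ} (ht : 0 < t) := (hu.integrableOn_Ioi_and_integral_abs_le hp hω hB ht).1
    have hc := hu.tendsto_atTop one_pos (hi one_pos)
    exact ⟨_, hc, fun t ht => ⟨hi ht, hu.eq_sub_integral_Ioi hc ht (hi ht)⟩,
      fun t ht => hu.abs_sub_le hp hω hB hc ht⟩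
  · have hd := dNorm_nonneg (p := p) hω u'
    refine ⟨by positivity, fun h t ht => ?_⟩
    have hd0 : dNorm p ω u' = 0 := by linarith [abs_nonneg c]
    have hc0 : c = 0 := abs_eq_zero.1 (by linarith)
    have := hu.abs_sub_le_dNorm hp hω hB hc ht
    rw [hd0, hc0, zero_mul, sub_zero] at this
    exact abs_nonpos_iff.1 this
  · have hΩ := omegaInf_nonneg (p := p) hω ha
    refine ⟨1 + OmegaInf p ω a, by linarith, fun u u' c hu hc => ?_⟩
    have hd := dNorm_nonneg (p := p) hω u'
    have hle := hu.abs_sub_le_dNorm hp hω hB hc ha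
    have h1 := abs_sub_abs_le_abs_sub (u a) c
    have h2 := abs_sub_abs_le_abs_sub c (u a)
    rw [abs_sub_comm c] at h2
    rw [inv_mul_le_iff₀ (by linarith), aNorm]
    constructor
    · nlinarith [mul_nonneg hΩ (abs_nonneg (u a))]
    · nlinarith [mul_nonneg hΩ (abs_nonneg c)]

end
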